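/- Assume every ξ_r is a positive real number (zero imaginary part, positive real part). Then for every real x > 1/2, the values ξ_+(x) and ξ(x−1/2) are real and satisfy ξ_+(x) > ξ(x−1/2) > 0. -/

import Mathlib

open Complex

/-- The Riemann xi function: `ξ(s) = (s(s-1)/2)·Λ₀(s) + 1/2`. -/
noncomputable def xi (s : ℂ) : ℂ := s * (s - 1) / 2 * completedRiemannZeta₀ s + 1 / 2

/-- `ξ_r = ξ^{(2r)}(1/2) / (2r)!`. -/
noncomputable def xiCoeff (r : ℕ) : ℂ := iteratedDeriv (2 * r) xi (1 / 2) / ((2 * r).factorial : ℂ)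

/-- `ξ₊(s) = (1/2)(ξ(s+1/2) + ξ(s−1/2))`. -/
noncomputable def xiPlus (s : ℂ) : ℂ := (1 / 2) * (xi (s + 1 / 2) + xi (s - 1 / 2))

/-- `ξ₋(s) = (1/2)(ξ(s+1/2) − ξ(s−1/2))`. -/
noncomputable def xiMinus (s : ℂ) : ℂ := (1 / 2) * (xi (s + 1 / 2) - xi (s - 1 / 2))

theorem differentiable_xi : Differentiable ℂ xi := by
  unfold xi
  have := differentiable_completedZeta₀
  fun_prop

theorem xi_one_sub (s : ℂ) : xi (1 - s) = xi s := by
  simp only [xi, completedRiemannZeta₀_one_sub]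
  ring

theorem iteratedDeriv_xi_half_of_odd {n : ℕ} (hn : Odd n) : iteratedDeriv n xi (1 / 2) = 0 := by
  have key := congrFun (iteratedDeriv_comp_const_sub n xi 1) (1 / 2)
  simp only [xi_one_sub, hn.neg_one_pow] at key
  norm_num at key
  norm_num
  exact self_eq_neg.mp key

theorem hasSum_xi_half_add (u : ℂ) :
    HasSum (fun r ↦ xiCoeff r * u ^ (2 * r)) (xi (1 / 2 + u)) := by
  have taylor := Complex.hasSum_taylorSeries_of_entire differentiable_xi (1 / 2) (1 / 2 + u)
  rw [← (mul_right_injective₀ (two_ne_zero' ℕ)).hasSum_iff] at taylor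
  · refine taylor.congr_fun fun r ↦ ?_
    simp [xiCoeff, div_eq_inv_mul]
    ring
  · intro n hn
    have hodd : Odd n := by
      rw [← Nat.not_even_iff_odd]
      rintro ⟨k, rfl⟩
      exact hn ⟨k, two_mul k⟩
    rw [iteratedDeriv_xi_half_of_odd hodd, smul_zero, smul_zero]

theorem xi_half_add_ofReal_im (h : ∀ r, (xiCoeff r).im = 0) (u : ℝ) :
    (xi (1 / 2 + u)).im = 0 := by
  refine (Complex.hasSum_im (hasSum_xi_half_add u)).unique ?_
  convert hasSum_zero with r
  rw [← ofReal_pow, im_mul_ofReal, h, zero_mul]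

theorem hasSum_re_xi_half_add_ofReal (u : ℝ) :
    HasSum (fun r ↦ (xiCoeff r).re * u ^ (2 * r)) (xi (1 / 2 + u)).re := by
  convert Complex.hasSum_re (hasSum_xi_half_add u) using 2 with r
  rw [← ofReal_pow, re_mul_ofReal]

theorem re_xi_half_add_ofReal_pos (h : ∀ r, 0 < (xiCoeff r).re) (u : ℝ) :
    0 < (xi (1 / 2 + u)).re := by
  have nonneg (r : ℕ) : 0 ≤ (xiCoeff r).re * u ^ (2 * r) :=
    mul_nonneg (h r).le ((even_two_mul r).pow_nonneg u)
  have le := le_hasSum (hasSum_re_xi_half_add_ofReal u) 0 fun r _ ↦ nonneg r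
  simp only [mul_zero, pow_zero, mul_one] at le
  exact (h 0).trans_le le

theorem re_xi_half_add_ofReal_lt (h : ∀ r, 0 < (xiCoeff r).re) {u v : ℝ} (huv : u ^ 2 < v ^ 2) :
    (xi (1 / 2 + u)).re < (xi (1 / 2 + v)).re := by
  refine hasSum_lt (i := 1) (fun r ↦ ?_) ?_ (hasSum_re_xi_half_add_ofReal u)
    (hasSum_re_xi_half_add_ofReal v)
  · simp only [pow_mul]
    have := (h r).le
    gcongr
  · simpa using mul_lt_mul_of_pos_left huv (h 1)

/-- Inequality (31): if all `ξ_r` are positive reals, then for real `x > 1/2` the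
values `ξ₊(x)` and `ξ(x−1/2)` are real and `ξ₊(x) > ξ(x−1/2) > 0`. -/
theorem xiPlus_gt_xi_shift_of_xiCoeff_pos
    (h : ∀ r : ℕ, (xiCoeff r).im = 0 ∧ 0 < (xiCoeff r).re)
    (x : ℝ) (hx : 1 / 2 < x) :
    (xiPlus (x : ℂ)).im = 0 ∧ (xi ((x : ℂ) - 1 / 2)).im = 0 ∧
    (xi ((x : ℂ) - 1 / 2)).re < (xiPlus (x : ℂ)).re ∧
    0 < (xi ((x : ℂ) - 1 / 2)).re := by
  have hleft : (x : ℂ) - 1 / 2 = 1 / 2 + ((x - 1 : ℝ) : ℂ) := by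
    push_cast
    ring
  have him := xi_half_add_ofReal_im fun r ↦ (h r).1
  have hpos (r : ℕ) := (h r).2
  have hlt : (xi (1 / 2 + ((x - 1 : ℝ) : ℂ))).re < (xi (1 / 2 + (x : ℂ))).re :=
    re_xi_half_add_ofReal_lt hpos (by nlinarith)
  have hhalf : (1 / 2 : ℂ) = ((1 / 2 : ℝ) : ℂ) := by norm_num
  have hplus : xiPlus x =
      ((1 / 2 : ℝ) : ℂ) * (xi (1 / 2 + x) + xi (1 / 2 + ((x - 1 : ℝ) : ℂ))) := by
    rw [xiPlus, hleft, add_comm (x : ℂ), ← hhalf]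
  rw [hplus, hleft, im_ofReal_mul, re_ofReal_mul, add_im, add_re, him, him]
  refine ⟨by simp, rfl, by linarith, re_xi_half_add_ofReal_pos hpos _⟩
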